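/- Let (X,d) be a metric space and S a finite labeled set (labels in {−1,1}) containing points of both labels; for z ∈ S let d_enemy(z) = min{d(z,z′) : z′ ∈ S, z′ has label opposite to z}. Let S̃ ⊆ S and suppose that for every x ∈ S there exists x̃ ∈ S̃ with the same label as x such that d(x,x̃) < d_enemy(x̃). Then for every x ∈ S: d(x,x̃)/d_enemy(x̃) < 1, while every x̃′ ∈ S̃ with label opposite to x satisfies d(x,x̃′)/d_enemy(x̃′) ≥ 1; hence the WNN classifier on S̃ with weights w(z) = d_enemy(z) labels every point of S correctly. -/

import Mathlib

/-- Consistency of WNN with nearest-enemy weights (the weight scheme of Section 4):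
`S` is a finite labeled set containing both labels, `d_enemy z` (characterized via
`IsLeast`) is the minimal distance from `z` to an oppositely-labeled point of `S`.
If every `x ∈ S` has a same-labeled `x̃ ∈ S̃` with `dist x x̃ < d_enemy x̃`, then the
weighted distance from `x` to `x̃` is `< 1`, that to every oppositely-labeled point
of `S̃` is `≥ 1`, and any weighted-distance minimizer over `S̃` has the label of `x`:
the WNN classifier on `S̃` with nearest-enemy weights is consistent on `S`. -/
theorem stmt16 {X : Type*} [MetricSpace X] (S : Finset X) (l : X → Bool)
    (hpos : ∃ x ∈ S, l x = true) (hneg : ∃ x ∈ S, l x = false)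
    (denemy : X → ℝ)
    (hd : ∀ z ∈ S, IsLeast {ρ : ℝ | ∃ z' ∈ S, l z' ≠ l z ∧ ρ = dist z z'} (denemy z))
    (St : Finset X) (hSt : St ⊆ S)
    (hcov : ∀ x ∈ S, ∃ x' ∈ St, l x' = l x ∧ dist x x' < denemy x') :
    ∀ x ∈ S, ∃ x' ∈ St, l x' = l x ∧
      dist x x' / denemy x' < 1 ∧
      (∀ x'' ∈ St, l x'' ≠ l x →
        1 ≤ dist x x'' / denemy x'' ∧
        dist x x' / denemy x' < dist x x'' / denemy x'') ∧
      ∀ z ∈ St, (∀ z' ∈ St, dist x z / denemy z ≤ dist x z' / denemy z') →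
        l z = l x := by
  have hpos_enemy : ∀ z ∈ S, 0 < denemy z := by
    intro z hz
    obtain ⟨z', -, hl, h⟩ := (hd z hz).1
    rw [h]
    exact dist_pos.2 fun h => hl (h ▸ rfl)
  intro x hx
  obtain ⟨x', hx', hl, hlt⟩ := hcov x hx
  have hlt_one : dist x x' / denemy x' < 1 := (div_lt_one (hpos_enemy x' (hSt hx'))).2 hlt
  have hge_one : ∀ y ∈ St, l y ≠ l x → 1 ≤ dist x y / denemy y := fun y hy hly =>
    (one_le_div (hpos_enemy y (hSt hy))).2
      ((hd y (hSt hy)).2 ⟨x, hx, hly.symm, dist_comm x y⟩)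
  refine ⟨x', hx', hl, hlt_one,
    fun y hy hly => ⟨hge_one y hy hly, hlt_one.trans_le (hge_one y hy hly)⟩, fun z hz hmin => ?_⟩
  by_contra hlz
  exact absurd (hmin x' hx') (not_le.2 (hlt_one.trans_le (hge_one z hz hlz)))
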